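/- Every local automorphism of the algebra W(2) is an automorphism. -/

import Mathlib

set_option maxSynthPendingDepth 3

/-- The 2-dimensional vector space `V₂ = F²`, with standard basis `v₁ = (1,0)`, `v₂ = (0,1)`. -/
abbrev V2 (F : Type*) [Field F] := Fin 2 → F

/-- The fixed vector `v₁` (the first standard basis vector of `V₂`). -/
noncomputable def v1 (F : Type*) [Field F] : V2 F := Pi.single 0 1

/-- `W(2)`: the space of all bilinear multiplications on `V₂`. -/
abbrev Wtwo (F : Type*) [Field F] := V2 F →ₗ[F] V2 F →ₗ[F] V2 F

variable {F : Type*} [Field F]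

/-- The Kantor product on `W(2)`:
`(A·B)(x,y) = A(v₁, B(x,y)) − B(A(v₁,x), y) − B(x, A(v₁,y))`. -/
noncomputable def wmul (A B : Wtwo F) : Wtwo F :=
  LinearMap.mk₂ F
    (fun x y => A (v1 F) (B x y) - B (A (v1 F) x) y - B x (A (v1 F) y))
    (fun x x' y => by simp only [map_add, LinearMap.add_apply]; abel)
    (fun c x y => by simp only [map_smul, LinearMap.smul_apply, smul_sub])
    (fun x y y' => by simp only [map_add, LinearMap.add_apply]; abel)
    (fun c x y => by simp only [map_smul, LinearMap.smul_apply, smul_sub])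

/-- An automorphism of `W(2)`: a bijective linear map that is multiplicative. -/
def IsAutomorphism (φ : Wtwo F →ₗ[F] Wtwo F) : Prop :=
  Function.Bijective φ ∧ ∀ x y : Wtwo F, φ (wmul x y) = wmul (φ x) (φ y)

/-- The second standard basis vector of `V₂`. -/
noncomputable def v2 (F : Type*) [Field F] : V2 F := Pi.single 1 1

/-- The natural action of the Lie algebra `gl(V₂)` on bilinear multiplications. -/
noncomputable def lieAct (a : V2 F →ₗ[F] V2 F) (B : Wtwo F) : Wtwo F :=
  B.compr₂ a - B.comp a - B.compl₂ a

/-- The endomorphism with matrix `!![p, q; r, u]` in the standard basis. -/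
noncomputable def matEnd (p q r u : F) : V2 F →ₗ[F] V2 F :=
  Matrix.toLin' !![p, q; r, u]

/-- The multiplication `(x, y) ↦ x₁ a(y)`, a preimage of `a` under `A ↦ A(v₁, ·)`. -/
noncomputable def leftLift (a : V2 F →ₗ[F] V2 F) : Wtwo F :=
  (LinearMap.proj 0 : V2 F →ₗ[F] F).smulRight a

/-- The multiplication `(x, y) ↦ x₂ y₂ v₁`. -/
noncomputable def lowestMul (F : Type*) [Field F] : Wtwo F :=
  (LinearMap.proj 1 : V2 F →ₗ[F] F).smulRight (matEnd 0 1 0 0)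

/-- The multiplication `(x, y) ↦ x₁ y₁ v₂`. -/
noncomputable def highestMul (F : Type*) [Field F] : Wtwo F := leftLift (matEnd 0 0 1 0)

@[simp] lemma v1_zero : v1 F 0 = 1 := by simp [v1]
@[simp] lemma v1_one : v1 F 1 = 0 := by simp [v1]
@[simp] lemma v2_zero : v2 F 0 = 0 := by simp [v2]
@[simp] lemma v2_one : v2 F 1 = 1 := by simp [v2]

lemma eq_smul_add_smul (x : V2 F) : x = x 0 • v1 F + x 1 • v2 F := by
  ext i; fin_cases i <;> simp

lemma end_apply (a : V2 F →ₗ[F] V2 F) (x : V2 F) (i : Fin 2) :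
    a x i = x 0 * a (v1 F) i + x 1 * a (v2 F) i := by
  conv_lhs => rw [eq_smul_add_smul x]
  simp

lemma mul_apply_apply (B : Wtwo F) (x y : V2 F) (i : Fin 2) :
    B x y i = x 0 * (y 0 * B (v1 F) (v1 F) i + y 1 * B (v1 F) (v2 F) i) +
      x 1 * (y 0 * B (v2 F) (v1 F) i + y 1 * B (v2 F) (v2 F) i) := by
  conv_lhs => rw [eq_smul_add_smul x]
  simp [end_apply (B _) y]

lemma end_ext {a b : V2 F →ₗ[F] V2 F} (h1 : a (v1 F) = b (v1 F)) (h2 : a (v2 F) = b (v2 F)) :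
    a = b := by
  refine LinearMap.ext fun x => ?_
  rw [eq_smul_add_smul x, map_add, map_add, map_smul, map_smul, map_smul, map_smul, h1, h2]

lemma mul_ext {A B : Wtwo F} (h1 : A (v1 F) = B (v1 F)) (h2 : A (v2 F) = B (v2 F)) : A = B := by
  refine LinearMap.ext fun x => ?_
  rw [eq_smul_add_smul x, map_add, map_add, map_smul, map_smul, map_smul, map_smul, h1, h2]

@[simp] lemma matEnd_apply_zero (p q r u : F) (x : V2 F) :
    matEnd p q r u x 0 = p * x 0 + q * x 1 := by
  simp [matEnd, Matrix.mulVec, dotProduct, Fin.sum_univ_two]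

@[simp] lemma matEnd_apply_one (p q r u : F) (x : V2 F) :
    matEnd p q r u x 1 = r * x 0 + u * x 1 := by
  simp [matEnd, Matrix.mulVec, dotProduct, Fin.sum_univ_two]

@[simp] lemma lieAct_apply (a : V2 F →ₗ[F] V2 F) (B : Wtwo F) (x y : V2 F) :
    lieAct a B x y = a (B x y) - B (a x) y - B x (a y) := rfl

@[simp] lemma leftLift_apply (a : V2 F →ₗ[F] V2 F) (x y : V2 F) :
    leftLift a x y = x 0 • a y := rfl

@[simp] lemma leftLift_v1 (a : V2 F →ₗ[F] V2 F) : leftLift a (v1 F) = a := by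
  refine LinearMap.ext fun y => ?_; simp

@[simp] lemma lowestMul_apply (x y : V2 F) :
    lowestMul F x y = x 1 • matEnd 0 1 0 0 y := rfl

@[simp] lemma highestMul_apply (x y : V2 F) :
    highestMul F x y = x 0 • matEnd 0 0 1 0 y := rfl

lemma highestMul_v1 : highestMul F (v1 F) = matEnd 0 0 1 0 := leftLift_v1 _

lemma wmul_eq_lieAct (A B : Wtwo F) : wmul A B = lieAct (A (v1 F)) B := rfl

lemma lieAct_sub_left (a b : V2 F →ₗ[F] V2 F) (B : Wtwo F) :
    lieAct (a - b) B = lieAct a B - lieAct b B := by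
  refine LinearMap.ext₂ fun x y => ?_
  simp; abel

lemma lieAct_sub_right (a : V2 F →ₗ[F] V2 F) (B C : Wtwo F) :
    lieAct a (B - C) = lieAct a B - lieAct a C := by
  refine LinearMap.ext₂ fun x y => ?_
  simp; abel

lemma lieAct_commutator (a b : V2 F →ₗ[F] V2 F) (B : Wtwo F) :
    lieAct (a.comp b - b.comp a) B = lieAct a (lieAct b B) - lieAct b (lieAct a B) := by
  refine LinearMap.ext₂ fun x y => ?_
  simp; abel

lemma eq_zero_of_forall_lieAct {a : V2 F →ₗ[F] V2 F} (h : ∀ B, lieAct a B = 0) : a = 0 := by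
  have key (B : Wtwo F) (x y : V2 F) (i : Fin 2) : lieAct a B x y i = 0 := by simp [h B]
  have h1 := key (leftLift (matEnd 0 0 1 0)) (v1 F) (v1 F)
  have h2 := key (leftLift (matEnd 1 0 0 0)) (v1 F) (v1 F)
  have h10 := h1 0
  have h11 := h1 1
  have h20 := h2 0
  have h21 := h2 1
  simp [end_apply a (matEnd _ _ _ _ _)] at h10 h11 h20 h21
  apply end_ext <;> ext i <;> fin_cases i <;> simp <;> grind

namespace IsAutomorphism

variable {φ ψ : Wtwo F →ₗ[F] Wtwo F}

lemma comp (hφ : IsAutomorphism φ) (hψ : IsAutomorphism ψ) : IsAutomorphism (φ.comp ψ) :=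
  ⟨hφ.1.comp hψ.1, fun x y => by simp [hφ.2, hψ.2]⟩

/-- The map induced on `gl(V₂)` by an automorphism, via `A ↦ A(v₁, ·)`. -/
noncomputable def theta (φ : Wtwo F →ₗ[F] Wtwo F) (a : V2 F →ₗ[F] V2 F) : V2 F →ₗ[F] V2 F :=
  φ (leftLift a) (v1 F)

lemma map_lieAct (hφ : IsAutomorphism φ) (a : V2 F →ₗ[F] V2 F) (B : Wtwo F) :
    φ (lieAct a B) = lieAct (theta φ a) (φ B) := by
  have := hφ.2 (leftLift a) B
  rwa [wmul_eq_lieAct, leftLift_v1] at this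

lemma eq_theta (hφ : IsAutomorphism φ) {a b : V2 F →ₗ[F] V2 F}
    (h : ∀ B, φ (lieAct a B) = lieAct b (φ B)) : theta φ a = b := by
  rw [← sub_eq_zero]
  apply eq_zero_of_forall_lieAct
  intro B
  obtain ⟨B, rfl⟩ := hφ.1.2 B
  rw [lieAct_sub_left, ← hφ.map_lieAct, h, sub_self]

lemma theta_apply_v1 (hφ : IsAutomorphism φ) (A : Wtwo F) : theta φ (A (v1 F)) = φ A (v1 F) :=
  hφ.eq_theta fun B => hφ.2 A B

lemma theta_commutator (hφ : IsAutomorphism φ) (a b : V2 F →ₗ[F] V2 F) :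
    theta φ (a.comp b - b.comp a) =
      (theta φ a).comp (theta φ b) - (theta φ b).comp (theta φ a) :=
  hφ.eq_theta fun B => by
    simp only [lieAct_commutator, map_sub, hφ.map_lieAct]

lemma theta_smul (φ : Wtwo F →ₗ[F] Wtwo F) (c : F) (a : V2 F →ₗ[F] V2 F) :
    theta φ (c • a) = c • theta φ a := by
  have : leftLift (c • a) = c • leftLift a := by
    exact LinearMap.ext₂ fun x y => smul_comm (x 0) c (a y)
  simp [theta, this]

lemma theta_add (φ : Wtwo F →ₗ[F] Wtwo F) (a b : V2 F →ₗ[F] V2 F) :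
    theta φ (a + b) = theta φ a + theta φ b := by
  have : leftLift (a + b) = leftLift a + leftLift b := by
    refine LinearMap.ext₂ fun x y => ?_
    simp
  simp [theta, this]

end IsAutomorphism

/-- The natural action of `GL(V₂)` on bilinear multiplications. -/
noncomputable def glAct (g : V2 F ≃ₗ[F] V2 F) : Wtwo F ≃ₗ[F] Wtwo F :=
  g.arrowCongr (g.arrowCongr g)

@[simp] lemma glAct_apply (g : V2 F ≃ₗ[F] V2 F) (A : Wtwo F) (x y : V2 F) :
    glAct g A x y = g (A (g.symm x) (g.symm y)) := rfl

lemma glAct_symm_glAct (g : V2 F ≃ₗ[F] V2 F) (A : Wtwo F) : glAct g.symm (glAct g A) = A := by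
  refine LinearMap.ext₂ fun x y => ?_
  simp

lemma glAct_glAct_symm (g : V2 F ≃ₗ[F] V2 F) (A : Wtwo F) : glAct g (glAct g.symm A) = A := by
  refine LinearMap.ext₂ fun x y => ?_
  simp

lemma isAutomorphism_glAct {g : V2 F ≃ₗ[F] V2 F} (hg : g (v1 F) = v1 F) :
    IsAutomorphism (glAct g).toLinearMap := by
  refine ⟨(glAct g).bijective, fun A B => ?_⟩
  have hg' : g.symm (v1 F) = v1 F := by rw [LinearEquiv.symm_apply_eq, hg]
  refine LinearMap.ext₂ fun x y => ?_
  simp [wmul, hg']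

/-- The shear-dilation fixing `v₁` and sending `v₂` to `(b, d)`. -/
noncomputable def stabEquiv (b d : F) (hd : d ≠ 0) : V2 F ≃ₗ[F] V2 F :=
  LinearEquiv.ofLinearMap (matEnd 1 b 0 d) (matEnd 1 (-b / d) 0 d⁻¹)
    (by apply end_ext <;> ext i <;> fin_cases i <;> simp <;> field_simp; ring)
    (by apply end_ext <;> ext i <;> fin_cases i <;> simp <;> field_simp; ring)

@[simp] lemma stabEquiv_apply (b d : F) (hd : d ≠ 0) (x : V2 F) :
    stabEquiv b d hd x = matEnd 1 b 0 d x := rfl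

@[simp] lemma stabEquiv_symm_apply (b d : F) (hd : d ≠ 0) (x : V2 F) :
    (stabEquiv b d hd).symm x = matEnd 1 (-b / d) 0 d⁻¹ x := rfl

lemma stabEquiv_v1 (b d : F) (hd : d ≠ 0) : stabEquiv b d hd (v1 F) = v1 F := by
  ext i; fin_cases i <;> simp

lemma lieAct_lieAct_lieAct_of_comp_self_eq_zero {a : V2 F →ₗ[F] V2 F} (ha : ∀ x, a (a x) = 0)
    (B : Wtwo F) (x y : V2 F) :
    lieAct a (lieAct a (lieAct a B)) x y = (6 : F) • a (B (a x) (a y)) := by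
  simp [ha]
  module

lemma lieAct_lowestMul :
    lieAct (matEnd 0 0 1 0) (lieAct (matEnd 0 0 1 0) (lieAct (matEnd 0 0 1 0) (lowestMul F))) =
      (6 : F) • highestMul F := by
  refine LinearMap.ext₂ fun x y => ?_
  rw [lieAct_lieAct_lieAct_of_comp_self_eq_zero]
  · ext i; fin_cases i <;> simp
  · intro x; ext i; fin_cases i <;> simp

lemma commutator_diag_lower :
    (matEnd 1 0 0 (-1) : V2 F →ₗ[F] V2 F).comp (matEnd 0 0 1 0) -
      (matEnd 0 0 1 0).comp (matEnd 1 0 0 (-1)) = (-2 : F) • matEnd 0 0 1 0 := by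
  apply end_ext <;> ext i <;> fin_cases i <;> simp; ring

lemma commutator_diag_upper :
    (matEnd 1 0 0 (-1) : V2 F →ₗ[F] V2 F).comp (matEnd 0 1 0 0) -
      (matEnd 0 1 0 0).comp (matEnd 1 0 0 (-1)) = (2 : F) • matEnd 0 1 0 0 := by
  apply end_ext <;> ext i <;> fin_cases i <;> simp; ring

lemma commutator_upper_lower :
    (matEnd 0 1 0 0 : V2 F →ₗ[F] V2 F).comp (matEnd 0 0 1 0) -
      (matEnd 0 0 1 0).comp (matEnd 0 1 0 0) = matEnd 1 0 0 (-1) := by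
  apply end_ext <;> ext i <;> fin_cases i <;> simp

section CharZero

variable [CharZero F]

lemma apply_apply_eq_zero_of_commutator {a b : V2 F →ₗ[F] V2 F}
    (h : b.comp a - a.comp b = (-2 : F) • a) (x : V2 F) : a (a x) = 0 := by
  have key (x : V2 F) (i : Fin 2) : (b (a x) - a (b x)) i = ((-2 : F) • a x) i :=
    congrFun (LinearMap.congr_fun h x) i
  have h10 := key (v1 F) 0
  have h11 := key (v1 F) 1
  have h20 := key (v2 F) 0
  have h21 := key (v2 F) 1
  simp [end_apply a (b _), end_apply b (a _)] at h10 h11 h20 h21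
  have htr : a (v2 F) 1 = - a (v1 F) 0 := by
    have : (2 : F) * (a (v2 F) 1 + a (v1 F) 0) = 0 := by linear_combination h10 + h21
    have := (mul_eq_zero.mp this).resolve_left two_ne_zero
    linear_combination this
  have hdet : a (v1 F) 0 * a (v1 F) 0 + a (v2 F) 0 * a (v1 F) 1 = 0 := by
    have : (4 : F) * (a (v1 F) 0 * a (v1 F) 0 + a (v2 F) 0 * a (v1 F) 1) = 0 := by
      rw [htr] at *
      grind
    exact (mul_eq_zero.mp this).resolve_left (by norm_num)
  ext i
  fin_cases i <;> simp [end_apply a (a _), end_apply a x] <;> rw [htr] <;> grind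

namespace IsAutomorphism

variable {φ : Wtwo F →ₗ[F] Wtwo F}

lemma exists_map_highestMul (hφ : IsAutomorphism φ) :
    ∃ g : V2 F ≃ₗ[F] V2 F, g (v1 F) = v1 F ∧ φ (highestMul F) = glAct g (highestMul F) := by
  set N := theta φ (matEnd 0 0 1 0)
  have hNN : ∀ x, N (N x) = 0 := by
    have := hφ.theta_commutator (matEnd 1 0 0 (-1)) (matEnd 0 0 1 0)
    rw [commutator_diag_lower, theta_smul] at this
    exact apply_apply_eq_zero_of_commutator this.symm
  set B := φ (lowestMul F)
  have hP (x y : V2 F) : φ (highestMul F) x y = N (B (N x) (N y)) := by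
    have h6 := congrArg φ (lieAct_lowestMul (F := F))
    rw [hφ.map_lieAct, hφ.map_lieAct, hφ.map_lieAct, map_smul] at h6
    have := LinearMap.congr_fun₂ h6 x y
    rw [lieAct_lieAct_lieAct_of_comp_self_eq_zero hNN] at this
    exact (smul_right_injective _ (by norm_num : (6 : F) ≠ 0) this).symm
  have hPN (y : V2 F) : N y = N (B (N (v1 F)) (N y)) := by
    rw [← hP, ← hφ.theta_apply_v1, highestMul_v1]
  have hNne : N ≠ 0 := by
    intro h0
    have : φ (highestMul F) = φ 0 := by
      refine LinearMap.ext₂ fun x y => ?_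
      rw [hP, h0]; simp
    have := congrFun (LinearMap.congr_fun₂ (hφ.1.1 this) (v1 F) (v1 F)) 1
    simp at this
  have hd : N (v1 F) 1 ≠ 0 := by
    intro hd
    have h1 : N (v1 F) = 0 := by
      have h := congrFun (hNN (v1 F)) 0
      rw [end_apply, hd] at h
      ext i; fin_cases i
      · simpa using h
      · exact hd
    apply hNne
    refine LinearMap.ext fun y => ?_
    rw [hPN, h1]; simp
  have hNv2 : N (v2 F) = (-(N (v1 F) 0) / N (v1 F) 1) • N (v1 F) := by
    have h := hNN (v1 F)
    rw [eq_smul_add_smul (N (v1 F)), map_add, map_smul, map_smul] at h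
    have h' := eq_neg_of_add_eq_zero_right h
    rw [← inv_smul_smul₀ hd (N (v2 F)), h', smul_neg, smul_smul, ← neg_smul]
    congr 1; ring
  have hNx (x : V2 F) : N x = (x 0 + -(N (v1 F) 0) / N (v1 F) 1 * x 1) • N (v1 F) := by
    conv_lhs => rw [eq_smul_add_smul x]
    rw [map_add, map_smul, map_smul, hNv2]
    module
  refine ⟨stabEquiv (N (v1 F) 0) (N (v1 F) 1) hd, stabEquiv_v1 _ _ _, ?_⟩
  refine LinearMap.ext₂ fun x y => ?_
  rw [hP, hNx x, map_smul, LinearMap.smul_apply, map_smul, ← hPN, hNx y]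
  ext i; fin_cases i <;> simp <;> left <;> ring

lemma eq_id_of_map_highestMul (hφ : IsAutomorphism φ) (h : φ (highestMul F) = highestMul F) :
    φ = LinearMap.id := by
  have hn : theta φ (matEnd 0 0 1 0) = matEnd 0 0 1 0 := by
    rw [← highestMul_v1, hφ.theta_apply_v1, h]
  have hh : theta φ (matEnd 1 0 0 (-1)) = matEnd 1 0 0 (-1) := by
    have hw : lieAct (matEnd 1 0 0 (-1)) (highestMul F) = (-3 : F) • highestMul F := by
      refine LinearMap.ext₂ fun x y => ?_
      ext i; fin_cases i <;> simp; ring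
    have hl : lieAct (matEnd 1 0 0 (-1)) (lowestMul F) = (3 : F) • lowestMul F := by
      refine LinearMap.ext₂ fun x y => ?_
      ext i; fin_cases i <;> simp; ring
    have hc := hφ.theta_commutator (matEnd 1 0 0 (-1)) (matEnd 0 0 1 0)
    rw [commutator_diag_lower, theta_smul, hn] at hc
    replace hw := congrArg φ hw
    rw [hφ.map_lieAct, map_smul, h] at hw
    replace hl := congrArg φ hl
    rw [hφ.map_lieAct, map_smul] at hl
    have h6 := congrArg φ (lieAct_lowestMul (F := F))
    rw [hφ.map_lieAct, hφ.map_lieAct, hφ.map_lieAct, map_smul, hn, h] at h6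
    have hX : φ (lowestMul F) (v1 F) = 0 := by
      have h0 : lowestMul F (v1 F) = 0 := LinearMap.ext fun y => by simp
      rw [← hφ.theta_apply_v1, h0]
      simpa using theta_smul φ 0 0
    set X := φ (lowestMul F)
    set H := theta φ (matEnd 1 0 0 (-1))
    have hX' (y : V2 F) : X (v1 F) y = 0 := by rw [hX]; rfl
    have c1 := congrFun (LinearMap.congr_fun hc (v1 F)) 1
    have w10 := congrFun (LinearMap.congr_fun₂ hw (v1 F) (v1 F)) 0
    have w11 := congrFun (LinearMap.congr_fun₂ hw (v1 F) (v1 F)) 1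
    have l10 := congrFun (LinearMap.congr_fun₂ hl (v1 F) (v2 F)) 0
    have s0 := congrFun (LinearMap.congr_fun₂ h6 (v1 F) (v1 F)) 1
    rw [lieAct_lieAct_lieAct_of_comp_self_eq_zero
      (by intro x; ext i; fin_cases i <;> simp)] at s0
    simp [end_apply H (matEnd _ _ _ _ _), mul_apply_apply X (H _),
      mul_apply_apply X (matEnd _ _ _ _ _), hX'] at c1 w10 w11 l10 s0
    have hp : H (v1 F) 0 = 1 := by linear_combination -c1 - w11
    have hu : H (v2 F) 1 = -1 := by linear_combination -2 * c1 - w11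
    have hr : H (v1 F) 1 = 0 := l10.resolve_right (by simp [s0])
    apply end_ext <;> ext i <;> fin_cases i <;> simp [hp, hu, hr, w10]
  have he : theta φ (matEnd 0 1 0 0) = matEnd 0 1 0 0 := by
    have h1 := hφ.theta_commutator (matEnd 1 0 0 (-1)) (matEnd 0 1 0 0)
    rw [commutator_diag_upper, theta_smul, hh] at h1
    have h2 := hφ.theta_commutator (matEnd 0 1 0 0) (matEnd 0 0 1 0)
    rw [commutator_upper_lower, hh, hn] at h2
    set E := theta φ (matEnd 0 1 0 0)
    have a10 := congrFun (LinearMap.congr_fun h1 (v1 F)) 0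
    have a11 := congrFun (LinearMap.congr_fun h1 (v1 F)) 1
    have a21 := congrFun (LinearMap.congr_fun h1 (v2 F)) 1
    have b10 := congrFun (LinearMap.congr_fun h2 (v1 F)) 0
    simp [end_apply E (matEnd _ _ _ _ _)] at a10 a11 a21 b10
    apply end_ext <;> ext i <;> fin_cases i <;> simp <;> grind
  have hid : theta φ LinearMap.id = LinearMap.id := by
    apply hφ.eq_theta
    intro B
    have (C : Wtwo F) : lieAct LinearMap.id C = -C :=
      LinearMap.ext₂ fun x y => by simp
    rw [this, this, map_neg]
  have hθ (a : V2 F →ₗ[F] V2 F) : theta φ a = a := by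
    have ha : a = ((a (v1 F) 0 + a (v2 F) 1) / 2) • LinearMap.id +
        ((a (v1 F) 0 - a (v2 F) 1) / 2) • matEnd 1 0 0 (-1) +
        a (v2 F) 0 • matEnd 0 1 0 0 + a (v1 F) 1 • matEnd 0 0 1 0 := by
      apply end_ext <;> ext i <;> fin_cases i <;> simp <;> ring
    rw [ha]
    simp only [theta_add, theta_smul, hn, hh, he, hid]
  have hL (A : Wtwo F) : (φ A - A) (v1 F) = 0 := by
    rw [LinearMap.sub_apply, ← hφ.theta_apply_v1, hθ, sub_self]
  ext1 A
  rw [LinearMap.id_apply, ← sub_eq_zero]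
  have hC : lieAct (matEnd 0 0 1 0) (φ A - A) (v1 F) = 0 := by
    rw [lieAct_sub_right, ← hL (lieAct (matEnd 0 0 1 0) A), hφ.map_lieAct, hn]
  apply mul_ext
  · rw [hL]; rfl
  · have hv : matEnd 0 0 1 0 (v1 F) = v2 F := by ext i; fin_cases i <;> simp
    refine LinearMap.ext fun y => ?_
    have := LinearMap.congr_fun hC y
    rw [lieAct_apply, hL, hv] at this
    exact neg_eq_zero.mp (by simpa using this)

lemma exists_eq_glAct (hφ : IsAutomorphism φ) :
    ∃ g : V2 F ≃ₗ[F] V2 F, g (v1 F) = v1 F ∧ ∀ A, φ A = glAct g A := by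
  obtain ⟨g, hg, h⟩ := hφ.exists_map_highestMul
  refine ⟨g, hg, fun A => ?_⟩
  have hg' : g.symm (v1 F) = v1 F := by rw [LinearEquiv.symm_apply_eq, hg]
  have hid := ((isAutomorphism_glAct hg').comp hφ).eq_id_of_map_highestMul
    (by simp [h, glAct_symm_glAct])
  have := LinearMap.congr_fun hid A
  rw [← glAct_glAct_symm g (φ A)]
  exact congrArg _ this

end IsAutomorphism

end CharZero

lemma eq_self_of_forall_exists_glAct {T : Wtwo F →ₗ[F] Wtwo F}
    (hT : ∀ A, ∃ g : V2 F ≃ₗ[F] V2 F, g (v1 F) = v1 F ∧ T A = glAct g A)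
    (h : T (highestMul F) = highestMul F) (A : Wtwo F) : T A = A := by
  have heval (A : Wtwo F) : ∃ g : V2 F ≃ₗ[F] V2 F, g (v1 F) = v1 F ∧ T A = glAct g A ∧
      T A (v1 F) (v1 F) = g (A (v1 F) (v1 F)) := by
    obtain ⟨g, hg, hA⟩ := hT A
    have hg' : g.symm (v1 F) = v1 F := by rw [LinearEquiv.symm_apply_eq, hg]
    exact ⟨g, hg, hA, by rw [hA, glAct_apply, hg']⟩
  have hw : highestMul F (v1 F) (v1 F) = v2 F := by ext i; fin_cases i <;> simp
  have hlow (C : Wtwo F) (c : F) (hC : C (v1 F) (v1 F) = c • v1 F) : T C = C := by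
    obtain ⟨g, hg, -, hgv⟩ := heval C
    rw [hC, map_smul, hg] at hgv
    obtain ⟨k, hk, hkA, hkv⟩ := heval (highestMul F + C)
    have hk2 : k (v2 F) = v2 F := by
      simpa [h, hw, hC, hk, hgv] using hkv.symm
    have hkx (x : V2 F) : k x = x := by
      rw [eq_smul_add_smul x, map_add, map_smul, map_smul, hk, hk2]
    have hkx' (x : V2 F) : k.symm x = x := by rw [LinearEquiv.symm_apply_eq, hkx]
    have hone : glAct k (highestMul F + C) = highestMul F + C := by
      refine LinearMap.ext₂ fun x y => ?_
      rw [glAct_apply, hkx, hkx', hkx']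
    rw [hone, map_add, h] at hkA
    exact add_left_cancel hkA
  have := hlow (A - A (v1 F) (v1 F) 1 • highestMul F) (A (v1 F) (v1 F) 0) (by
    ext i; fin_cases i <;> simp)
  rw [map_sub, map_smul, h] at this
  exact sub_left_injective this

/-- Every local automorphism of the algebra `W(2)` is an automorphism. -/
theorem every_localAutomorphism_isAutomorphism {F : Type*} [Field F] [CharZero F]
    (T : Wtwo F →ₗ[F] Wtwo F)
    (hT : ∀ x : Wtwo F, ∃ φ : Wtwo F →ₗ[F] Wtwo F, IsAutomorphism φ ∧ T x = φ x) :
    IsAutomorphism T := by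
  obtain ⟨φ, hφ, hTφ⟩ := hT (highestMul F)
  obtain ⟨g, hg, hφg⟩ := hφ.exists_eq_glAct
  have hg' : g.symm (v1 F) = v1 F := by rw [LinearEquiv.symm_apply_eq, hg]
  have hT' (A : Wtwo F) : glAct g.symm (T A) = A := by
    refine eq_self_of_forall_exists_glAct (T := (glAct g.symm).toLinearMap.comp T) ?_ ?_ A
    · intro A
      obtain ⟨ψ, hψ, hTψ⟩ := hT A
      obtain ⟨k, hk, hk'⟩ := ((isAutomorphism_glAct hg').comp hψ).exists_eq_glAct
      exact ⟨k, hk, by rw [← hk']; simp [hTψ]⟩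
    · simp [hTφ, hφg, glAct_symm_glAct]
  have : T = (glAct g).toLinearMap := by
    ext1 A
    rw [← glAct_glAct_symm g (T A), hT']; rfl
  rw [this]
  exact isAutomorphism_glAct hg
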